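/- Let S be a finite set, s_i ∈ S, and t ∉ S. If the responsibility of t in the set S \ {s_i} ∪ {t} is strictly smaller than the responsibility of s_i in the original set S, then replacing s_i with t is a valid replacement, i.e. κ̃(S \ {s_i} ∪ {t}) < κ̃(S). -/

import Mathlib

open Finset

/-- Optimization objective κ̃(S): the sum of κ over all unordered pairs of
distinct elements of S, encoded as half the sum over ordered distinct pairs
(these agree since κ is assumed symmetric). -/
noncomputable def obj {X : Type*} [DecidableEq X] (κ : X → X → ℝ) (S : Finset X) : ℝ :=
  (1 / 2) * ∑ p ∈ S.offDiag, κ p.1 p.2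

/-- Responsibility of s in S: rsp_S(s) = (1/2) Σ_{j ∈ S, j ≠ s} κ(s, j). -/
noncomputable def rsp {X : Type*} [DecidableEq X] (κ : X → X → ℝ) (S : Finset X) (s : X) : ℝ :=
  (1 / 2) * ∑ j ∈ S.erase s, κ s j

lemma obj_insert_aux {X : Type*} [DecidableEq X] (κ : X → X → ℝ)
    (hsymm : ∀ x y, κ x y = κ y x) (A : Finset X) (a : X) (ha : a ∉ A) :
    obj κ (insert a A) = obj κ A + 2 * rsp κ (insert a A) a := by
  have h1 : Disjoint A.offDiag ({a} ×ˢ A) := by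
    rw [Finset.disjoint_left]
    rintro ⟨x, y⟩ hx hy
    simp only [Finset.mem_offDiag, Finset.mem_product, Finset.mem_singleton] at hx hy
    exact ha (hy.1 ▸ hx.1)
  have h2 : Disjoint (A.offDiag ∪ {a} ×ˢ A) (A ×ˢ {a}) := by
    rw [Finset.disjoint_left]
    rintro ⟨x, y⟩ hx hy
    simp only [Finset.mem_union, Finset.mem_offDiag, Finset.mem_product,
      Finset.mem_singleton] at hx hy
    rcases hx with hx | hx
    · exact ha (hy.2 ▸ hx.2.1)
    · exact ha (hy.2 ▸ hx.2)
  unfold obj rsp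
  rw [Finset.offDiag_insert ha, Finset.sum_union h2, Finset.sum_union h1,
    Finset.erase_insert ha, Finset.sum_product, Finset.sum_product]
  simp only [Finset.sum_singleton]
  rw [Finset.sum_congr rfl (fun x _ => hsymm x a)]
  ring

/-- if rsp of t in S \ {sᵢ} ∪ {t} is smaller than rsp of sᵢ in S,
then replacing sᵢ by t is a valid replacement. -/
theorem stmt_6 {X : Type*} [DecidableEq X] (κ : X → X → ℝ)
    (hsymm : ∀ x y, κ x y = κ y x)
    (S : Finset X) (sᵢ t : X) (hsi : sᵢ ∈ S) (ht : t ∉ S)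
    (h : rsp κ (insert t (S.erase sᵢ)) t < rsp κ S sᵢ) :
    obj κ (insert t (S.erase sᵢ)) < obj κ S := by
  have h1 := obj_insert_aux κ hsymm (S.erase sᵢ) t (fun hm => ht (Finset.mem_of_mem_erase hm))
  have h2 := obj_insert_aux κ hsymm (S.erase sᵢ) sᵢ (Finset.notMem_erase sᵢ S)
  rw [Finset.insert_erase hsi] at h2
  linarith
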